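/- Let G be a finite abelian group and A ⊆ G a finite set with at least 2 elements. Then Σ_{s ≠ 0} Σ_{t ≠ 0} |A_s − A_t| ≥ |A|⁸ / (4·E₄(A)) and Σ_{s ≠ 0} Σ_{t ≠ 0} |A_s + A_t| ≥ |A|⁸ / (4·E₄(A)), where the sums range over nonzero s, t ∈ G. -/

import Mathlib

open Finset Pointwise

section helpers
variable {G : Type*} [AddCommGroup G] [Fintype G] [DecidableEq G]

/-- The set `A ∩ (A - s)`. -/
def shiftInter (A : Finset G) (s : G) : Finset G := A ∩ A.image (fun a => a - s)

lemma mem_shiftInter (A : Finset G) (s a : G) : a ∈ shiftInter A s ↔ a ∈ A ∧ a + s ∈ A := by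
  simp only [shiftInter, Finset.mem_inter, Finset.mem_image]
  constructor
  · rintro ⟨h, b, hb, rfl⟩
    simpa [h] using And.intro h hb
  · rintro ⟨h, h'⟩
    exact ⟨h, a + s, h', by simp⟩

lemma shiftInter_comm (A : Finset G) (s d : G) :
    shiftInter (shiftInter A s) d = shiftInter (shiftInter A d) s := by
  ext a
  simp only [mem_shiftInter, add_right_comm a s d]
  tauto

lemma shiftInter_zero (A : Finset G) : shiftInter A 0 = A := by
  ext a
  simp [mem_shiftInter]

lemma sum_card_shiftInter (A : Finset G) : ∑ s : G, #(shiftInter A s) = #A ^ 2 := by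
  rw [sq, ← Finset.card_product,
    Finset.card_eq_sum_card_fiberwise (f := fun x : G × G => x.2 - x.1) (t := Finset.univ)
      (fun _ _ => by simp)]
  refine Finset.sum_congr rfl fun s _ => ?_
  refine Finset.card_nbij' (fun a => (a, a + s)) (fun x => x.1) ?_ ?_ ?_ ?_
  · intro a ha
    simpa [mem_shiftInter] using ha
  · rintro ⟨a, b⟩ h
    simp only [Finset.coe_filter, Finset.mem_product, Set.mem_ofPred_eq] at h
    obtain ⟨⟨ha, hb⟩, rfl⟩ := h
    simpa [mem_shiftInter] using And.intro ha hb
  · intro a _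
    rfl
  · rintro ⟨a, b⟩ h
    simp only [Finset.coe_filter, Finset.mem_product, Set.mem_ofPred_eq] at h
    obtain ⟨⟨ha, hb⟩, rfl⟩ := h
    simp

lemma sum_card_shiftInter_ne (A : Finset G) :
    ∑ s ∈ Finset.univ.filter (fun s : G => s ≠ 0), (#(shiftInter A s) : ℝ)
      = (#A : ℝ) ^ 2 - #A := by
  have h : (∑ s : G, (#(shiftInter A s) : ℝ)) = (#A : ℝ) ^ 2 := by
    exact_mod_cast sum_card_shiftInter A
  rw [← h, Finset.filter_ne' , ← Finset.sum_erase_add _ _ (Finset.mem_univ (0 : G)),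
    shiftInter_zero]
  ring

lemma addEnergy_eq_sum_shiftInter (B C : Finset G) :
    Finset.addEnergy B C = ∑ d : G, #(shiftInter B d) * #(shiftInter C d) := by
  rw [Finset.addEnergy,
    Finset.card_eq_sum_card_fiberwise (f := fun x : (G × G) × G × G => x.1.2 - x.1.1)
      (t := Finset.univ) (fun _ _ => by simp)]
  refine Finset.sum_congr rfl fun d _ => ?_
  rw [← Finset.card_product]
  symm
  refine Finset.card_nbij' (fun x => ((x.1, x.1 + d), (x.2 + d, x.2)))
    (fun x => (x.1.1, x.2.2)) ?_ ?_ ?_ ?_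
  · rintro ⟨a, b⟩ h
    simp only [Finset.coe_product, Set.mem_prod, Finset.mem_coe, mem_shiftInter] at h
    obtain ⟨⟨h1, h2⟩, h3, h4⟩ := h
    simp only [Finset.coe_filter, Finset.mem_filter, Finset.mem_product, Set.mem_ofPred_eq]
    refine ⟨⟨⟨⟨h1, h2⟩, h4, h3⟩, by abel⟩, by abel⟩
  · rintro ⟨⟨a, a'⟩, b, b'⟩ h
    simp only [Finset.coe_filter, Finset.mem_filter, Finset.mem_product, Set.mem_ofPred_eq] at h
    obtain ⟨⟨⟨⟨h1, h2⟩, h3, h4⟩, h5⟩, rfl⟩ := h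
    have hb : b = b' + (a' - a) := by
      rw [← sub_eq_zero] at h5 ⊢
      rw [← h5]; abel
    simp only [Finset.coe_product, Set.mem_prod, Finset.mem_coe, mem_shiftInter]
    rw [← hb]
    simp [h1, h2, h3, h4]
  · rintro ⟨a, b⟩ _
    rfl
  · rintro ⟨⟨a, a'⟩, b, b'⟩ h
    simp only [Finset.coe_filter, Finset.mem_filter, Finset.mem_product, Set.mem_ofPred_eq] at h
    obtain ⟨⟨⟨⟨h1, h2⟩, h3, h4⟩, h5⟩, rfl⟩ := h
    have hb : b = b' + (a' - a) := by
      rw [← sub_eq_zero] at h5 ⊢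
      rw [← h5]; abel
    simp [hb]

lemma sum_addEnergy (A : Finset G) :
    ∑ s ∈ Finset.univ.filter (fun s : G => s ≠ 0), ∑ t ∈ Finset.univ.filter (fun t : G => t ≠ 0),
      (Finset.addEnergy (shiftInter A s) (shiftInter A t) : ℝ)
      = ∑ d : G, ((#(shiftInter A d) : ℝ) ^ 2 - #(shiftInter A d)) ^ 2 := by
  simp_rw [← sum_card_shiftInter_ne (shiftInter A _), sq, Finset.sum_mul_sum,
    addEnergy_eq_sum_shiftInter]
  push_cast
  rw [Finset.sum_comm (s := Finset.univ)]
  refine Finset.sum_congr rfl fun s _ => ?_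
  rw [Finset.sum_comm (s := Finset.univ)]
  refine Finset.sum_congr rfl fun t _ => ?_
  refine Finset.sum_congr rfl fun d _ => ?_
  rw [shiftInter_comm A s d, shiftInter_comm A t d]

lemma card_shiftInter_neg (C : Finset G) (d : G) :
    #(shiftInter (-C) d) = #(shiftInter C d) := by
  refine Finset.card_nbij' (fun a => -a - d) (fun a => -a - d) ?_ ?_ ?_ ?_
  · intro a ha
    simp only [Finset.mem_coe, mem_shiftInter, Finset.mem_neg'] at ha ⊢
    refine ⟨?_, by simpa using ha.1⟩
    have := ha.2
    rwa [neg_add, ← sub_eq_add_neg] at this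
  · intro a ha
    simp only [Finset.mem_coe, mem_shiftInter, Finset.mem_neg'] at ha ⊢
    refine ⟨?_, by simpa using ha.1⟩
    have := ha.2
    rwa [neg_sub, sub_neg_eq_add, add_comm]
  · intro a _
    simp
  · intro a _
    simp

lemma addEnergy_neg_right_aux (B C : Finset G) :
    Finset.addEnergy B (-C) = Finset.addEnergy B C := by
  simp only [addEnergy_eq_sum_shiftInter, card_shiftInter_neg]

lemma final_arith (n S E T : ℝ) (hn2 : 2 ≤ n) (hS0 : 0 ≤ S) (hEpos : 0 < E)
    (cs : ((n ^ 2 - n) * (n ^ 2 - n)) ^ 2 ≤ S * T) (hTE : n ^ 2 * T ≤ (n - 1) ^ 2 * E) :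
    n ^ 8 / (4 * E) ≤ S := by
  have h1 : 0 < n - 1 := by linarith
  have h0 : 0 < n := by linarith
  have key : n ^ 6 * (n - 1) ^ 2 ≤ S * E := by
    have hp : 0 < (n - 1) ^ 2 := by positivity
    refine le_of_mul_le_mul_right ?_ hp
    calc n ^ 6 * (n - 1) ^ 2 * (n - 1) ^ 2 = n ^ 2 * (n ^ 4 * (n - 1) ^ 4) := by ring
      _ ≤ n ^ 2 * (n ^ 4 * (n - 1) ^ 4) := le_rfl
      _ ≤ S * E * (n - 1) ^ 2 := ?_
    have := mul_le_mul_of_nonneg_left hTE hS0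
    have h2 := mul_le_mul_of_nonneg_left cs (sq_nonneg n)
    have h3 : n ^ 2 * (n ^ 4 * (n - 1) ^ 4) = n ^ 2 * ((n ^ 2 - n) * (n ^ 2 - n)) ^ 2 := by ring
    nlinarith
  rw [div_le_iff₀ (by positivity)]
  have h4 : n ^ 2 ≤ (2 * (n - 1)) ^ 2 := by
    have : n ≤ 2 * (n - 1) := by linarith
    exact pow_le_pow_left₀ h0.le this 2
  have h5 : n ^ 6 * n ^ 2 ≤ n ^ 6 * (2 * (n - 1)) ^ 2 :=
    mul_le_mul_of_nonneg_left h4 (by positivity)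
  calc n ^ 8 = n ^ 6 * n ^ 2 := by ring
    _ ≤ n ^ 6 * (2 * (n - 1)) ^ 2 := h5
    _ = 4 * (n ^ 6 * (n - 1) ^ 2) := by ring
    _ ≤ 4 * (S * E) := by linarith
    _ = _ := by ring

lemma main_bound (A : Finset G) (hA : 2 ≤ #A) (F : G → G → ℝ) (hF : ∀ s t, 0 ≤ F s t)
    (h : ∀ s t, ((#(shiftInter A s) : ℝ) * #(shiftInter A t)) ^ 2 ≤
      F s t * Finset.addEnergy (shiftInter A s) (shiftInter A t)) :
    (#A : ℝ) ^ 8 / (4 * ∑ s : G, (#(shiftInter A s) : ℝ) ^ 4) ≤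
        ∑ s ∈ Finset.univ.filter (fun s : G => s ≠ 0),
          ∑ t ∈ Finset.univ.filter (fun t : G => t ≠ 0), F s t := by
  set U := Finset.univ.filter (fun s : G => s ≠ 0) with hU
  have cs := Finset.sum_sq_le_sum_mul_sum_of_sq_le_mul (U ×ˢ U)
    (r := fun x => (#(shiftInter A x.1) : ℝ) * #(shiftInter A x.2))
    (f := fun x => F x.1 x.2)
    (g := fun x => (Finset.addEnergy (shiftInter A x.1) (shiftInter A x.2) : ℝ))
    (fun x _ => hF _ _) (fun x _ => by positivity) (fun x _ => h _ _)
  rw [Finset.sum_product, Finset.sum_product, Finset.sum_product] at cs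
  simp only at cs
  rw [← Finset.sum_mul_sum, sum_card_shiftInter_ne, sum_addEnergy] at cs
  set S := ∑ s ∈ U, ∑ t ∈ U, F s t with hS
  have hS0 : 0 ≤ S := Finset.sum_nonneg fun s _ => Finset.sum_nonneg fun t _ => hF s t
  set E := ∑ s : G, (#(shiftInter A s) : ℝ) ^ 4 with hE
  set T := ∑ d : G, ((#(shiftInter A d) : ℝ) ^ 2 - #(shiftInter A d)) ^ 2 with hT
  set n : ℝ := (#A : ℝ) with hn
  have hn2 : (2 : ℝ) ≤ n := by rw [hn]; exact_mod_cast hA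
  have hTE : n ^ 2 * T ≤ (n - 1) ^ 2 * E := by
    rw [hT, hE, Finset.mul_sum, Finset.mul_sum]
    refine Finset.sum_le_sum fun d _ => ?_
    have hx : (#(shiftInter A d) : ℝ) ≤ n := by
      rw [hn]; exact_mod_cast Finset.card_le_card Finset.inter_subset_left
    rcases Nat.eq_zero_or_pos #(shiftInter A d) with h0 | h0
    · simp [h0]
    have hx1 : (1 : ℝ) ≤ #(shiftInter A d) := by exact_mod_cast h0
    set x : ℝ := (#(shiftInter A d) : ℝ)
    have h1 : n * (x ^ 2 - x) ≤ (n - 1) * x ^ 2 := by nlinarith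
    have h2 : 0 ≤ n * (x ^ 2 - x) := mul_nonneg (by linarith) (by nlinarith)
    calc n ^ 2 * (x ^ 2 - x) ^ 2 = (n * (x ^ 2 - x)) ^ 2 := by ring
      _ ≤ ((n - 1) * x ^ 2) ^ 2 := by gcongr
      _ = _ := by ring
  have hEpos : 0 < E := by
    refine Finset.sum_pos' (fun _ _ => by positivity) ⟨0, Finset.mem_univ _, ?_⟩
    rw [shiftInter_zero]
    have : 0 < n := by linarith
    positivity
  exact final_arith n S E T hn2 hS0 hEpos cs hTE

end helpers

theorem sumsets_A_s_A_t_lower_bound {G : Type*} [AddCommGroup G] [Fintype G] [DecidableEq G]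
    (A : Finset G) (hA : 2 ≤ A.card) :
    (A.card : ℝ) ^ 8 / (4 * ∑ s : G, ((A ∩ A.image (fun a => a - s)).card : ℝ) ^ 4) ≤
        ∑ s ∈ Finset.univ.filter (fun s : G => s ≠ 0),
          ∑ t ∈ Finset.univ.filter (fun t : G => t ≠ 0),
            (((A ∩ A.image (fun a => a - s)) - (A ∩ A.image (fun a => a - t))).card : ℝ) ∧
    (A.card : ℝ) ^ 8 / (4 * ∑ s : G, ((A ∩ A.image (fun a => a - s)).card : ℝ) ^ 4) ≤
        ∑ s ∈ Finset.univ.filter (fun s : G => s ≠ 0),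
          ∑ t ∈ Finset.univ.filter (fun t : G => t ≠ 0),
            (((A ∩ A.image (fun a => a - s)) + (A ∩ A.image (fun a => a - t))).card : ℝ) := by
  constructor
  · refine main_bound A hA
      (fun s t => ((shiftInter A s - shiftInter A t).card : ℝ)) (fun _ _ => by positivity) ?_
    intro s t
    have h := Finset.le_card_add_mul_addEnergy (shiftInter A s) (-shiftInter A t)
    rw [addEnergy_neg_right_aux, Finset.card_neg, ← sub_eq_add_neg] at h
    rw [mul_pow]
    exact_mod_cast h
  · refine main_bound A hA
      (fun s t => ((shiftInter A s + shiftInter A t).card : ℝ)) (fun _ _ => by positivity) ?_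
    intro s t
    have h := Finset.le_card_add_mul_addEnergy (shiftInter A s) (shiftInter A t)
    rw [mul_pow]
    exact_mod_cast h
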